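/- Let k, l, m, n be integers with k, m, n positive and l ≥ 0, satisfying (k+l+1)/n + (l+1)/m < 1. Then there is no non-constant polynomial H over ℂ such that H(0) ≠ 0, every zero of H has multiplicity at least n, and every zero of the polynomial H^{(k)}(ζ) − ζ^l has multiplicity at least m. -/

import Mathlib

open Polynomial

section DerivativeMultiplicity

variable {K : Type*} [Field K]

theorem natDegree_iterate_derivative_eq [CharZero K] (p : K[X]) (j : ℕ) :
    (derivative^[j] p).natDegree = p.natDegree - j := by
  induction j with
  | zero => simp
  | succ j ih =>
    rw [Function.iterate_succ_apply', natDegree_derivative, ih]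
    omega

theorem rootMultiplicity_le_iterate_derivative_add {p : K[X]} {j : ℕ}
    (h : derivative^[j] p ≠ 0) (z : K) :
    p.rootMultiplicity z ≤ (derivative^[j] p).rootMultiplicity z + j := by
  rw [← tsub_le_iff_right, le_rootMultiplicity_iff h]
  exact pow_sub_dvd_iterate_derivative_of_pow_dvd j (pow_rootMultiplicity_dvd p z)

theorem sum_rootMultiplicity_le_natDegree (p : K[X]) (S : Finset K) :
    ∑ z ∈ S, p.rootMultiplicity z ≤ p.natDegree := by
  classical
  calc ∑ z ∈ S, p.rootMultiplicity z
      ≤ ∑ z ∈ S ∪ p.roots.toFinset, p.rootMultiplicity z :=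
        Finset.sum_le_sum_of_subset Finset.subset_union_left
    _ = p.roots.card := by
        simp only [← count_roots]
        exact Multiset.sum_count_eq_card fun a ha => by simp_all
    _ ≤ p.natDegree := card_roots' p

variable [IsAlgClosed K] [DecidableEq K]

theorem sum_rootMultiplicity_roots_toFinset (p : K[X]) :
    ∑ z ∈ p.roots.toFinset, p.rootMultiplicity z = p.natDegree := by
  simp only [← count_roots]
  rw [Multiset.toFinset_sum_count_eq, (IsAlgClosed.splits p).natDegree_eq_card_roots]

theorem natDegree_le_sum_rootMultiplicity_iterate_derivative {p : K[X]} {j : ℕ}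
    (h : derivative^[j] p ≠ 0) :
    p.natDegree ≤ ∑ z ∈ p.roots.toFinset, (derivative^[j] p).rootMultiplicity z +
      p.roots.toFinset.card * j := by
  rw [← sum_rootMultiplicity_roots_toFinset p]
  calc _ ≤ ∑ z ∈ p.roots.toFinset, ((derivative^[j] p).rootMultiplicity z + j) :=
        Finset.sum_le_sum fun z _ => rootMultiplicity_le_iterate_derivative_add h z
    _ = _ := by simp [Finset.sum_add_distrib]

theorem card_roots_toFinset_mul_le_natDegree {p : K[X]} {n : ℕ}
    (h : ∀ z, p.IsRoot z → n ≤ p.rootMultiplicity z) :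
    p.roots.toFinset.card * n ≤ p.natDegree := by
  rw [← sum_rootMultiplicity_roots_toFinset p, ← smul_eq_mul]
  exact Finset.card_nsmul_le_sum _ _ _ fun z hz =>
    h z (isRoot_of_mem_roots (Multiset.mem_toFinset.mp hz))

end DerivativeMultiplicity

/-- **Polynomial case non-existence claim.** If `(k+l+1)/n + (l+1)/m < 1`, there is no
non-constant polynomial `H` over `ℂ` with `H 0 ≠ 0` such that every zero of `H` has
multiplicity at least `n` and every zero of `H⁽ᵏ⁾(ζ) − ζ^l` has multiplicity at least `m`. -/
theorem no_polynomial (k m n : ℕ) (l : ℕ) (hk : 1 ≤ k) (hm : 1 ≤ m) (hn : 1 ≤ n)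
    (hcond : ((k : ℝ) + (l : ℝ) + 1) / n + ((l : ℝ) + 1) / m < 1) :
    ¬∃ H : Polynomial ℂ, 0 < H.natDegree ∧ H.eval 0 ≠ 0 ∧
      (∀ z : ℂ, H.IsRoot z → n ≤ H.rootMultiplicity z) ∧
      (∀ z : ℂ, (derivative^[k] H - X ^ l).IsRoot z →
        m ≤ (derivative^[k] H - X ^ l).rootMultiplicity z) := by
  rintro ⟨H, hdeg, h0, hH, hP⟩
  have hn' : (0 : ℝ) < n := by exact_mod_cast hn
  have hm' : (0 : ℝ) < m := by exact_mod_cast hm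
  have hkn : k + l + 1 < n := by
    have : ((k : ℝ) + l + 1) / n < 1 := lt_of_le_of_lt (le_add_of_nonneg_right (by positivity)) hcond
    rw [div_lt_one hn'] at this
    exact_mod_cast this
  have hnN : n ≤ H.natDegree := by
    obtain ⟨z, hz⟩ := IsAlgClosed.exists_root H (natDegree_pos_iff_degree_pos.mp hdeg).ne'
    exact (hH z hz).trans (by simpa using sum_rootMultiplicity_le_natDegree H {z})
  set P := derivative^[k] H - X ^ l with hPdef
  have hPdeg : P.natDegree = H.natDegree - k := by
    rw [hPdef, natDegree_sub_eq_left_of_natDegree_lt, natDegree_iterate_derivative_eq]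
    rw [natDegree_iterate_derivative_eq, natDegree_X_pow]
    omega
  have hPH : derivative^[l + 1] P = derivative^[k + l + 1] H := by
    rw [hPdef, iterate_derivative_sub, iterate_derivative_eq_zero (p := X ^ l) (by simp),
      sub_zero, ← Function.iterate_add_apply, show l + 1 + k = k + l + 1 by omega]
  have hQdeg := natDegree_iterate_derivative_eq H (k + l + 1)
  have hQ : derivative^[k + l + 1] H ≠ 0 := by
    intro h
    rw [h, natDegree_zero] at hQdeg
    omega
  have hdisj : Disjoint H.roots.toFinset P.roots.toFinset := by
    rw [Finset.disjoint_left]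
    intro z hzH hzP
    have hzH := isRoot_of_mem_roots (Multiset.mem_toFinset.mp hzH)
    have hzP := isRoot_of_mem_roots (Multiset.mem_toFinset.mp hzP)
    have hz0 : z ≠ 0 := by
      rintro rfl
      exact h0 hzH
    have hk0 : (derivative^[k] H).IsRoot z :=
      isRoot_iterate_derivative_of_lt_rootMultiplicity (by have := hH z hzH; omega)
    rw [hPdef, IsRoot, eval_sub, hk0.eq_zero] at hzP
    simp [hz0] at hzP
  have hsum := sum_rootMultiplicity_le_natDegree (derivative^[k + l + 1] H)
    (H.roots.toFinset ∪ P.roots.toFinset)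
  rw [Finset.sum_union hdisj, hQdeg] at hsum
  have hHsum := natDegree_le_sum_rootMultiplicity_iterate_derivative hQ
  have hPsum := natDegree_le_sum_rootMultiplicity_iterate_derivative (p := P) (j := l + 1)
    (hPH ▸ hQ)
  rw [hPH, hPdeg] at hPsum
  have hs := card_roots_toFinset_mul_le_natDegree hH
  have ht := card_roots_toFinset_mul_le_natDegree hP
  rw [hPdeg] at ht
  set N := H.natDegree
  set s := H.roots.toFinset.card
  set t := P.roots.toFinset.card
  have hN : N ≤ s * (k + l + 1) + t * (l + 1) := by omega
  have hN' : (N : ℝ) ≤ s * (k + l + 1) + t * (l + 1) := by exact_mod_cast hN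
  have hs' : (s : ℝ) ≤ N / n := by
    rw [le_div_iff₀ hn']
    exact_mod_cast hs
  have ht' : (t : ℝ) ≤ N / m := by
    rw [le_div_iff₀ hm']
    exact_mod_cast ht.trans (Nat.sub_le _ _)
  have hNpos : (0 : ℝ) < N := by exact_mod_cast hdeg
  refine lt_irrefl (N : ℝ) ?_
  calc (N : ℝ) ≤ s * (k + l + 1) + t * (l + 1) := hN'
    _ ≤ N / n * (k + l + 1) + N / m * (l + 1) := by gcongr
    _ = N * (((k : ℝ) + l + 1) / n + ((l : ℝ) + 1) / m) := by ring
    _ < N := mul_lt_of_lt_one_right hNpos hcond
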